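/- arXiv:2212.08630 — 2 statements merged into one kernel-verified Lean document; each statement's English description precedes it below -/
import Mathlib

section
/- Let n ≥ 1 and k, l ≥ 0 be integers with l + k even and 2n ≥ l + k. Then the maps {E_β : β a (k,l)-Brauer partition} are linearly independent, and hence form a basis of Hom_{O(n)}((ℝⁿ)^{⊗k},(ℝⁿ)^{⊗l}); in particular dim Hom_{O(n)}((ℝⁿ)^{⊗k},(ℝⁿ)^{⊗l}) = (l+k−1)!!. -/
open Matrix

noncomputable section

/-- The matrix of `g^{⊗k}` in the standard basis of `(ℝⁿ)^{⊗k}`. -/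
def tpowM {n : ℕ} (k : ℕ) (g : Matrix (Fin n) (Fin n) ℝ) :
    Matrix (Fin k → Fin n) (Fin k → Fin n) ℝ :=
  Matrix.of fun I J => ∏ r, g (I r) (J r)

/-- The subspace `Hom_G((ℝⁿ)^{⊗k}, (ℝⁿ)^{⊗l})` of linear maps equivariant under
all matrices satisfying `P`. -/
def EquivSub {n : ℕ} (k l : ℕ) (P : Matrix (Fin n) (Fin n) ℝ → Prop) :
    Submodule ℝ (((Fin k → Fin n) → ℝ) →ₗ[ℝ] ((Fin l → Fin n) → ℝ)) where
  carrier := {φ | ∀ g : Matrix (Fin n) (Fin n) ℝ, P g →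
    φ ∘ₗ (tpowM k g).mulVecLin = (tpowM l g).mulVecLin ∘ₗ φ}
  add_mem' := by
    intro φ ψ hφ hψ g hg
    rw [LinearMap.add_comp, LinearMap.comp_add, hφ g hg, hψ g hg]
  zero_mem' := by
    intro g hg
    rw [LinearMap.zero_comp, LinearMap.comp_zero]
  smul_mem' := by
    intro c φ hφ g hg
    rw [LinearMap.smul_comp, LinearMap.comp_smul, hφ g hg]

/-- A partition of `{1, …, N}` into disjoint pairs (a perfect matching),
encoded as a fixed-point-free involution: the blocks are the sets `{p, pair p}`. -/
structure BrauerPairing (N : ℕ) where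
  pair : Fin N → Fin N
  invol : ∀ p, pair (pair p) = p
  ne : ∀ p, pair p ≠ p

/-- The matrix `E_β` of a `(k,l)`-Brauer partition `β`. -/
def brauerMatrix (n k l : ℕ) (β : BrauerPairing (l + k)) :
    Matrix (Fin l → Fin n) (Fin k → Fin n) ℝ :=
  Matrix.of fun I J =>
    ∏ p ∈ Finset.univ.filter (fun p => p < β.pair p),
      if Fin.append I J p = Fin.append I J (β.pair p) then (1 : ℝ) else 0

/-- invariance of a tensor under `O(n)` -/
def TInv {n N : ℕ} (T : (Fin N → Fin n) → ℝ) : Prop :=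
  ∀ g : Matrix (Fin n) (Fin n) ℝ, gᵀ * g = 1 → ∀ C : Fin N → Fin n,
    ∑ D : Fin N → Fin n, (∏ r, g (C r) (D r)) * T D = T C

/-- the tensor of a pairing -/
def pairT {n N : ℕ} (β : BrauerPairing N) (C : Fin N → Fin n) : ℝ :=
  ∏ p ∈ Finset.univ.filter (fun p => p < β.pair p),
      if C p = C (β.pair p) then (1 : ℝ) else 0

lemma BrauerPairing.ext_pair {N : ℕ} {β γ : BrauerPairing N} (h : ∀ p, β.pair p = γ.pair p) :
    β = γ := by
  cases β; cases γ
  simp only [BrauerPairing.mk.injEq]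
  funext p; exact h p

instance {N : ℕ} : Finite (BrauerPairing N) :=
  Finite.of_injective (fun β : BrauerPairing N => β.pair)
    (fun _ _ h => BrauerPairing.ext_pair (fun p => congrFun h p))

instance {N : ℕ} : DecidableEq (BrauerPairing N) := Classical.decEq _

instance {N : ℕ} : Fintype (BrauerPairing N) := Fintype.ofFinite _

lemma pairT_eq {n N : ℕ} (β : BrauerPairing N) (C : Fin N → Fin n) :
    pairT β C = if ∀ p, C p = C (β.pair p) then 1 else 0 := by
  unfold pairT
  split_ifs with h
  · apply Finset.prod_eq_one
    intro p _
    simp [← h p]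
  · push Not at h
    obtain ⟨p, hp⟩ := h
    rcases lt_or_gt_of_ne (β.ne p) with h1 | h1
    · apply Finset.prod_eq_zero (i := β.pair p)
      · simp [β.invol, h1]
      · simp [β.invol, Ne.symm hp]
    · apply Finset.prod_eq_zero (i := p)
      · simp [h1]
      · simp [hp]

/-- the splitting of the positions -/
def splitE {N : ℕ} (β : BrauerPairing N) :
    ({p : Fin N // p < β.pair p} ⊕ {p : Fin N // p < β.pair p}) ≃ Fin N :=
  Equiv.ofBijective (Sum.elim (fun p => p.1) (fun p => β.pair p.1)) (by
    constructor
    · rintro (⟨p, hp⟩ | ⟨p, hp⟩) (⟨q, hq⟩ | ⟨q, hq⟩) h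
      · simpa using h
      · simp only [Sum.elim_inl, Sum.elim_inr] at h
        subst h
        rw [β.invol] at hp
        exact absurd hp (lt_asymm hq)
      · simp only [Sum.elim_inl, Sum.elim_inr] at h
        subst h
        rw [β.invol] at hq
        exact absurd hp (lt_asymm hq)
      · simp only [Sum.elim_inr] at h
        have := congrArg β.pair h
        rw [β.invol, β.invol] at this
        subst this; rfl
    · intro p
      rcases lt_or_gt_of_ne (β.ne p) with h1 | h1
      · exact ⟨Sum.inr ⟨β.pair p, by rwa [β.invol]⟩, by simp [β.invol]⟩
      · exact ⟨Sum.inl ⟨p, h1⟩, rfl⟩)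

lemma tinv_pairT {n N : ℕ} (β : BrauerPairing N) : TInv (n := n) (pairT β) := by
  intro g hg C
  have hg' : g * gᵀ = 1 := mul_eq_one_comm.mp hg
  let H := {p : Fin N // p < β.pair p}
  let e : (H → Fin n × Fin n) ≃ (Fin N → Fin n) :=
    (Equiv.arrowProdEquivProdArrow H (fun _ => Fin n) (fun _ => Fin n)).trans
      ((Equiv.sumArrowEquivProdArrow H H (Fin n)).symm.trans
        (Equiv.arrowCongr (splitE β) (Equiv.refl _)))
  have hs1 : ∀ (f : H → Fin n × Fin n) (p : H), e f p.1 = (f p).1 := by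
    intro f p
    have : (splitE β).symm p.1 = Sum.inl p := by
      rw [Equiv.symm_apply_eq]; rfl
    simp [e, this, Equiv.sumArrowEquivProdArrow, Equiv.arrowProdEquivProdArrow]
  have hs2 : ∀ (f : H → Fin n × Fin n) (p : H), e f (β.pair p.1) = (f p).2 := by
    intro f p
    have : (splitE β).symm (β.pair p.1) = Sum.inr p := by
      rw [Equiv.symm_apply_eq]; rfl
    simp [e, this, Equiv.sumArrowEquivProdArrow, Equiv.arrowProdEquivProdArrow]
  have hpt : ∀ D : Fin N → Fin n, pairT β D = ∏ p : H, if D p.1 = D (β.pair p.1) then (1:ℝ) else 0 := by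
    intro D
    unfold pairT
    rw [Finset.prod_subtype (p := fun p => p < β.pair p)]
    simp
  have hprod : ∀ D : Fin N → Fin n, ∏ r, g (C r) (D r) =
      ∏ p : H, g (C p.1) (D p.1) * g (C (β.pair p.1)) (D (β.pair p.1)) := by
    intro D
    rw [← (splitE β).prod_comp, Fintype.prod_sum_type, Finset.prod_mul_distrib]
    rfl
  rw [← e.sum_comp]
  have : ∀ f : H → Fin n × Fin n, (∏ r, g (C r) (e f r)) * pairT β (e f) =
      ∏ p : H, (g (C p.1) (f p).1 * g (C (β.pair p.1)) (f p).2 *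
        if (f p).1 = (f p).2 then (1:ℝ) else 0) := by
    intro f
    rw [hprod, hpt, ← Finset.prod_mul_distrib]
    simp only [hs1, hs2]
  simp only [this]
  rw [← Fintype.piFinset_univ, Finset.sum_prod_piFinset Finset.univ (fun (p : H) (x : Fin n × Fin n) => (g (C p.1) x.1 * g (C (β.pair p.1)) x.2 *
        if x.1 = x.2 then (1:ℝ) else 0)), hpt]
  refine Finset.prod_congr rfl fun p _ => ?_
  rw [Fintype.sum_prod_type]
  have := congrFun (congrFun hg' (C p.1)) (C (β.pair p.1))
  rw [Matrix.mul_apply, Matrix.one_apply] at this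
  simp only [Matrix.transpose_apply] at this
  simp [this]

lemma tinv_perm {n N : ℕ} {T : (Fin N → Fin n) → ℝ} (hT : TInv T) (σ : Equiv.Perm (Fin n))
    (C : Fin N → Fin n) : T (fun r => σ (C r)) = T C := by
  have h := hT (Matrix.of fun i j => if j = σ i then (1:ℝ) else 0) (by
    ext i j
    rw [Matrix.mul_apply, ← σ.symm.sum_comp]
    simp [Matrix.one_apply]) C
  rw [← h, Finset.sum_eq_single (fun r => σ (C r))]
  · simp
  · intro D _ hD
    obtain ⟨r, hr⟩ := Function.ne_iff.mp hD
    rw [Finset.prod_eq_zero (Finset.mem_univ r), zero_mul]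
    simp [hr]
  · simp

lemma tinv_odd {n N : ℕ} {T : (Fin N → Fin n) → ℝ} (hT : TInv T) (C : Fin N → Fin n) (a : Fin n)
    (ha : Odd (Finset.univ.filter (fun r => C r = a)).card) : T C = 0 := by
  have h := hT (Matrix.diagonal fun i => if i = a then (-1:ℝ) else 1) (by
    rw [Matrix.diagonal_transpose, Matrix.diagonal_mul_diagonal, ← Matrix.diagonal_one]
    congr 1
    funext i
    split_ifs <;> norm_num) C
  rw [Finset.sum_eq_single C] at h
  · simp only [Matrix.diagonal_apply_eq] at h
    rw [Finset.prod_ite] at h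
    simp only [Finset.prod_const, one_pow, mul_one, ha.neg_one_pow] at h
    linarith
  · intro D _ hD
    obtain ⟨r, hr⟩ := Function.ne_iff.mp hD
    rw [Finset.prod_eq_zero (Finset.mem_univ r), zero_mul]
    rw [Matrix.diagonal_apply_ne _ (Ne.symm hr)]
  · simp

lemma tinv_lie {n N : ℕ} {T : (Fin N → Fin n) → ℝ} (hT : TInv T) (X : Matrix (Fin n) (Fin n) ℝ)
    (hX : Xᵀ = -X) (hX3 : X * X * X = -X) (C : Fin N → Fin n) :
    ∑ r, ∑ x, X (C r) x * T (Function.update C r x) = 0 := by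
  have hg : ∀ θ : ℝ, (1 + Real.sin θ • X + (1 - Real.cos θ) • (X * X))ᵀ *
      (1 + Real.sin θ • X + (1 - Real.cos θ) • (X * X)) = 1 := by
    intro θ
    have h4 : X * X * (X * X) = - (X * X) := by
      rw [← mul_assoc, hX3, neg_mul]
    have h3' : X * (X * X) = -X := by rw [← mul_assoc, hX3]
    simp only [Matrix.transpose_add, Matrix.transpose_smul, Matrix.transpose_mul, hX,
      Matrix.transpose_one, neg_mul, mul_neg, neg_neg, smul_neg, add_mul, mul_add, one_mul, mul_one,
      smul_mul_assoc, mul_smul_comm, h4, hX3, h3']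
    have hs := Real.sin_sq_add_cos_sq θ
    have : (2 * (1 - Real.cos θ) - (1 - Real.cos θ)^2 - Real.sin θ ^ 2) • (X * X) = 0 := by
      rw [show (2 * (1 - Real.cos θ) - (1 - Real.cos θ)^2 - Real.sin θ ^ 2) = 0 by linarith, zero_smul]
    rw [← sub_eq_zero, ← this]
    module
  have hd : ∀ i j, HasDerivAt (fun θ : ℝ =>
      (1 + Real.sin θ • X + (1 - Real.cos θ) • (X * X)) i j) (X i j) 0 := by
    intro i j
    have h1 := ((Real.hasDerivAt_sin 0).mul_const (X i j)).const_add ((1 : Matrix (Fin n) (Fin n) ℝ) i j)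
    have h2 := (((Real.hasDerivAt_cos 0).const_sub 1).mul_const ((X * X) i j))
    have := h1.add h2
    simpa [Pi.add_def] using this
  have hD : HasDerivAt (fun θ : ℝ => ∑ D : Fin N → Fin n,
      (∏ r, (1 + Real.sin θ • X + (1 - Real.cos θ) • (X * X)) (C r) (D r)) * T D)
      (∑ D : Fin N → Fin n, (∑ r, (∏ s ∈ Finset.univ.erase r,
        (1 : Matrix (Fin n) (Fin n) ℝ) (C s) (D s)) * X (C r) (D r)) * T D) 0 := by
    apply HasDerivAt.fun_sum
    intro D _
    apply HasDerivAt.mul_const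
    have := HasDerivAt.fun_finsetProd (u := Finset.univ) (fun (r : Fin N) _ => hd (C r) (D r))
    simpa using this
  have hc : (fun θ : ℝ => ∑ D : Fin N → Fin n,
      (∏ r, (1 + Real.sin θ • X + (1 - Real.cos θ) • (X * X)) (C r) (D r)) * T D) = fun _ => T C := by
    funext θ
    exact hT _ (hg θ) C
  rw [hc] at hD
  have h0 := hD.unique (hasDerivAt_const 0 (T C))
  refine Eq.trans ?_ h0
  simp only [Finset.sum_mul]
  symm
  rw [Finset.sum_comm]
  refine Finset.sum_congr rfl fun r _ => ?_
  have hsub : (Finset.univ.image (fun x => Function.update C r x)) ⊆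
      (Finset.univ : Finset (Fin N → Fin n)) := Finset.subset_univ _
  refine Eq.trans (Finset.sum_subset hsub ?_).symm ?_
  rotate_left
  · rw [Finset.sum_image (fun x _ y _ h => Function.update_injective C r h)]
    refine Finset.sum_congr rfl fun x _ => ?_
    rw [Finset.prod_eq_one, one_mul, Function.update_self]
    intro s hs
    rw [Function.update_of_ne (Finset.ne_of_mem_erase hs), Matrix.one_apply_eq]
  · intro D _ hD
    have : ∃ s, s ≠ r ∧ C s ≠ D s := by
      by_contra! hcon
      apply hD
      simp only [Finset.mem_image, Finset.mem_univ, true_and]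
      refine ⟨D r, ?_⟩
      funext s
      by_cases hs : s = r
      · subst hs; simp
      · rw [Function.update_of_ne hs, hcon s hs]
    obtain ⟨s, hs, hne⟩ := this
    have hz : ∏ s ∈ Finset.univ.erase r, (1 : Matrix (Fin n) (Fin n) ℝ) (C s) (D s) = 0 :=
      Finset.prod_eq_zero (i := s) (Finset.mem_erase.mpr ⟨hs, Finset.mem_univ _⟩)
        (Matrix.one_apply_ne hne)
    rw [hz, zero_mul, zero_mul]

lemma tinv_swap {n N : ℕ} {T : (Fin N → Fin n) → ℝ} (hT : TInv T) (C : Fin N → Fin n)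
    (a b : Fin n) (p : Fin N) (hp : C p = a) (hb : ∀ r, C r ≠ b) :
    T C = ∑ q ∈ Finset.univ.filter (fun q => q ≠ p ∧ C q = a),
      T (Function.update (Function.update C p b) q b) := by
  have hab : a ≠ b := by rw [← hp]; exact hb p
  have h := tinv_lie hT (Matrix.single a b 1 - Matrix.single b a 1)
    (by simp [Matrix.transpose_single]) (by
      simp [sub_mul, mul_sub, hab, hab.symm, Matrix.single_mul_single_of_ne]; abel) (Function.update C p b)
  have h2 : ∀ r, ∑ x, (Matrix.single a b (1:ℝ) - Matrix.single b a 1 : Matrix (Fin n) (Fin n) ℝ) (Function.update C p b r) x *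
      T (Function.update (Function.update C p b) r x) =
      (if r ≠ p ∧ C r = a then T (Function.update (Function.update C p b) r b) else 0) -
      (if r = p then T C else 0) := by
    intro r
    by_cases hr : r = p
    · subst hr
      subst hp
      simp [Matrix.single_apply, hab]
    · simp [Matrix.single_apply, hr, (hb r).symm, eq_comm (a := a), ite_and]
  simp only [h2, Finset.sum_sub_distrib] at h
  rw [Finset.sum_filter]
  simp at h ⊢
  linarith

lemma exists_label {n N : ℕ} (h2n : N ≤ 2 * n) (β : BrauerPairing N) :
    ∃ I : Fin N → Fin n, ∀ p q, I p = I q ↔ (q = p ∨ q = β.pair p) := by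
  have hc : Fintype.card {p : Fin N // p < β.pair p} ≤ Fintype.card (Fin n) := by
    have := Fintype.card_congr (splitE β)
    rw [Fintype.card_sum, Fintype.card_fin] at this
    rw [Fintype.card_fin]
    omega
  obtain ⟨f⟩ := Function.Embedding.nonempty_of_card_le hc
  have hm : ∀ p, min p (β.pair p) < β.pair (min p (β.pair p)) := by
    intro p
    rcases lt_or_gt_of_ne (β.ne p) with h1 | h1
    · rw [min_eq_right h1.le, β.invol]; exact h1
    · rw [min_eq_left h1.le]; exact h1
  refine ⟨fun p => f ⟨min p (β.pair p), hm p⟩, fun p q => ?_⟩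
  rw [f.injective.eq_iff, Subtype.mk.injEq]
  have hinj : ∀ x y, β.pair x = β.pair y → x = y := by
    intro x y h
    rw [← β.invol x, h, β.invol]
  constructor
  · intro h
    rcases min_choice p (β.pair p) with h1 | h1 <;> rcases min_choice q (β.pair q) with h2 | h2 <;>
      rw [h1, h2] at h
    · exact Or.inl h.symm
    · right; rw [h, β.invol]
    · exact Or.inr h.symm
    · exact Or.inl (hinj _ _ h).symm
  · rintro (rfl | rfl)
    · rfl
    · rw [β.invol, min_comm]

lemma exists_perm {n N : ℕ} (I J : Fin N → Fin n) (h : ∀ p q, I p = I q ↔ J p = J q) :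
    ∃ σ : Equiv.Perm (Fin n), ∀ p, σ (I p) = J p := by
  classical
  let f : {x // x ∈ Set.range I} → {x // x ∈ Set.range J} := fun x =>
    ⟨J x.2.choose, Set.mem_range_self _⟩
  have hf : ∀ p, f ⟨I p, Set.mem_range_self p⟩ = ⟨J p, Set.mem_range_self p⟩ := by
    intro p
    apply Subtype.ext
    exact (h _ _).mp (Set.mem_range_self p : I p ∈ Set.range I).choose_spec
  have hb : Function.Bijective f := by
    constructor
    · rintro ⟨_, p, rfl⟩ ⟨_, q, rfl⟩ hpq
      have h3 := ((hf p).symm.trans hpq).trans (hf q)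
      exact Subtype.ext ((h _ _).mpr (congrArg Subtype.val h3))
    · rintro ⟨_, p, rfl⟩
      exact ⟨_, hf p⟩
  refine ⟨(Equiv.ofBijective f hb).extendSubtype, fun p => ?_⟩
  rw [Equiv.extendSubtype_apply_of_mem _ _ ⟨p, rfl⟩, Equiv.ofBijective_apply, hf]

/-- a labelling of a pairing -/
def lab {n N : ℕ} (h2n : N ≤ 2 * n) (β : BrauerPairing N) : Fin N → Fin n :=
  (exists_label h2n β).choose

lemma lab_spec {n N : ℕ} (h2n : N ≤ 2 * n) (β : BrauerPairing N) :
    ∀ p q, lab h2n β p = lab h2n β q ↔ (q = p ∨ q = β.pair p) :=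
  (exists_label h2n β).choose_spec

lemma pairT_lab {n N : ℕ} (h2n : N ≤ 2 * n) (β γ : BrauerPairing N) :
    pairT β (lab h2n γ) = if β = γ then 1 else 0 := by
  rw [pairT_eq]
  congr 1
  rw [eq_iff_iff]
  constructor
  · intro h
    apply BrauerPairing.ext_pair
    intro p
    exact ((lab_spec h2n γ _ _).mp (h p)).resolve_left (β.ne p)
  · rintro rfl p
    rw [lab_spec]; exact Or.inr rfl

lemma vanish {n N : ℕ} (h2n : N ≤ 2 * n) {T : (Fin N → Fin n) → ℝ} (hT : TInv T)
    (h0 : ∀ γ, T (lab h2n γ) = 0) (C : Fin N → Fin n) : T C = 0 := by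
  classical
  induction hd : n - (Finset.univ.image C).card using Nat.strong_induction_on generalizing C with
  | _ d ih =>
  by_cases hodd : ∃ a, Odd (Finset.univ.filter (fun r => C r = a)).card
  · obtain ⟨a, ha⟩ := hodd
    exact tinv_odd hT C a ha
  simp only [not_exists, Nat.not_odd_iff_even] at hodd
  by_cases hbig : ∃ a, 2 < (Finset.univ.filter (fun r => C r = a)).card
  · obtain ⟨a, ha⟩ := hbig
    have hb : ∃ b, ∀ r, C r ≠ b := by
      by_contra! hcon
      have h2 : ∀ b, 2 ≤ (Finset.univ.filter (fun r => C r = b)).card := by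
        intro b
        obtain ⟨r, hr⟩ := hcon b
        have : 0 < (Finset.univ.filter (fun r => C r = b)).card :=
          Finset.card_pos.mpr ⟨r, by simp [hr]⟩
        obtain ⟨m, hm⟩ := hodd b
        omega
      have hs : ∑ b : Fin n, 2 < ∑ b : Fin n, (Finset.univ.filter (fun r => C r = b)).card :=
        Finset.sum_lt_sum (fun b _ => h2 b) ⟨a, Finset.mem_univ _, ha⟩
      rw [← Finset.card_eq_sum_card_fiberwise (s := Finset.univ) (t := Finset.univ) (f := C)
        (fun _ _ => by simp)] at hs
      simp at hs
      omega
    obtain ⟨b, hb⟩ := hb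
    obtain ⟨p, hp⟩ := Finset.card_pos.mp (by omega : 0 < (Finset.univ.filter (fun r => C r = a)).card)
    have hpa : C p = a := by simpa using hp
    rw [tinv_swap hT C a b p hpa hb]
    apply Finset.sum_eq_zero
    intro q hq
    simp only [Finset.mem_filter, Finset.mem_univ, true_and] at hq
    refine ih _ ?_ _ rfl
    have hsub : insert b (Finset.univ.image C) ⊆
        Finset.univ.image (Function.update (Function.update C p b) q b) := by
      intro x hx
      rw [Finset.mem_insert] at hx
      rw [Finset.mem_image]
      by_cases hxb : x = b
      · exact ⟨q, Finset.mem_univ _, by simp [hxb]⟩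
      have hx := hx.resolve_left hxb
      by_cases hxa : x = a
      · have : ∃ r ∈ Finset.univ.filter (fun r => C r = a), r ∉ ({p, q} : Finset (Fin N)) := by
          by_contra! hcon
          have := Finset.card_le_card (fun r hr => hcon r hr)
          have h3 := Finset.card_le_two (a := p) (b := q)
          omega
        obtain ⟨r, hr, hr2⟩ := this
        simp only [Finset.mem_insert, Finset.mem_singleton, not_or] at hr2
        refine ⟨r, Finset.mem_univ _, ?_⟩
        rw [Function.update_of_ne hr2.2, Function.update_of_ne hr2.1, hxa]
        simpa using hr
      · obtain ⟨r, -, hr⟩ := Finset.mem_image.mp hx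
        refine ⟨r, Finset.mem_univ _, ?_⟩
        rw [Function.update_of_ne, Function.update_of_ne, hr]
        · rintro rfl; exact hxa (hr.symm.trans hpa)
        · rintro rfl; exact hxa (hr.symm.trans hq.2)
    have hcard := Finset.card_le_card hsub
    rw [Finset.card_insert_of_notMem (by simp [hb])] at hcard
    have hle := Finset.card_le_univ (Finset.univ.image (Function.update (Function.update C p b) q b))
    rw [Fintype.card_fin] at hle
    omega
  · push Not at hbig
    have hex : ∀ p, ∃ q, q ≠ p ∧ ∀ r, C p = C r ↔ (r = p ∨ r = q) := by
      intro p
      have hpos : 0 < (Finset.univ.filter (fun r => C r = C p)).card :=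
        Finset.card_pos.mpr ⟨p, by simp⟩
      obtain ⟨m, hm⟩ := hodd (C p)
      have hle := hbig (C p)
      have h2 : (Finset.univ.filter (fun r => C r = C p)).card = 2 := by omega
      have hpm : p ∈ Finset.univ.filter (fun r => C r = C p) := by simp
      obtain ⟨x, y, hxy, he⟩ := Finset.card_eq_two.mp h2
      have hmem : ∀ r, C p = C r ↔ (r = x ∨ r = y) := by
        intro r
        have : r ∈ Finset.univ.filter (fun r => C r = C p) ↔ r ∈ ({x, y} : Finset (Fin N)) := by
          rw [he]
        simpa [eq_comm (a := C r)] using this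
      rcases (hmem p).mp rfl with rfl | rfl
      · exact ⟨y, hxy.symm, hmem⟩
      · exact ⟨x, hxy, fun r => by rw [hmem, or_comm]⟩
    choose f hf1 hf2 using hex
    let γ : BrauerPairing N := ⟨f, fun p => by
      have h1 : C p = C (f p) := (hf2 p (f p)).mpr (Or.inr rfl)
      have h2 := (hf2 (f p) p).mp h1.symm
      exact (h2.resolve_left (hf1 p).symm).symm, hf1⟩
    obtain ⟨σ, hσ⟩ := exists_perm (lab h2n γ) C (fun p q => by rw [lab_spec, hf2])
    have := tinv_perm hT σ (lab h2n γ)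
    rw [h0] at this
    rw [← this]
    congr 1
    funext p
    exact (hσ p).symm

lemma card_pairing (N : ℕ) (hN : Even N) :
    Fintype.card (BrauerPairing N) = Nat.doubleFactorial (N - 1) := by
  classical
  obtain ⟨m, rfl⟩ : ∃ m, N = 2 * m := by
    obtain ⟨m, hm⟩ := hN; exact ⟨m, by omega⟩
  have hch : ∀ g : Equiv.Perm (Fin (2 * m)), g.cycleType = Multiset.replicate m 2 ↔
      ((∀ p, g (g p) = p) ∧ ∀ p, g p ≠ p) := by
    intro g
    have hsq : (∀ p, g (g p) = p) ↔ g ^ 2 = 1 := by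
      rw [Equiv.ext_iff]; simp [pow_two]
    have hsupp : (∀ p, g p ≠ p) ↔ g.cycleType.sum = 2 * m := by
      rw [Equiv.Perm.sum_cycleType]
      constructor
      · intro h
        have : g.support = Finset.univ := by ext p; simp [h p]
        rw [this]; simp
      · intro h p
        have : g.support = Finset.univ := by
          rw [← Finset.card_eq_iff_eq_univ, h, Fintype.card_fin]
        rw [← Equiv.Perm.mem_support, this]; simp
    rw [hsq, hsupp, Equiv.Perm.pow_prime_eq_one_iff, Multiset.eq_replicate]
    constructor
    · rintro ⟨h1, h2⟩
      refine ⟨h2, ?_⟩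
      rw [Multiset.eq_replicate.mpr ⟨h1, h2⟩]
      simp [mul_comm]
    · rintro ⟨h1, h2⟩
      refine ⟨?_, h1⟩
      rw [Multiset.eq_replicate.mpr ⟨rfl, h1⟩, Multiset.sum_replicate, smul_eq_mul] at h2
      omega
  let e : BrauerPairing (2 * m) ≃ {g : Equiv.Perm (Fin (2 * m)) // g.cycleType = Multiset.replicate m 2} :=
    { toFun := fun β => ⟨⟨β.pair, β.pair, β.invol, β.invol⟩, (hch _).mpr ⟨β.invol, β.ne⟩⟩
      invFun := fun g => ⟨g.1, ((hch _).mp g.2).1, ((hch _).mp g.2).2⟩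
      left_inv := fun β => rfl
      right_inv := fun g => by ext; rfl }
  have hc := Equiv.Perm.card_of_cycleType_mul_eq (Fin (2 * m)) (Multiset.replicate m 2)
  rw [Fintype.card_congr e, Fintype.card_subtype]
  rw [if_pos ⟨by simp [mul_comm], fun a ha => (Multiset.eq_of_mem_replicate ha).ge⟩] at hc
  rcases Nat.eq_zero_or_pos m with rfl | hm
  · simpa using hc
  · obtain ⟨j, rfl⟩ : ∃ j, m = j + 1 := ⟨m - 1, by omega⟩
    rw [Multiset.toFinset_replicate, if_neg (by omega)] at hc
    have hf := Nat.factorial_eq_mul_doubleFactorial (2 * j + 1)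
    have hd := Nat.doubleFactorial_two_mul (j + 1)
    rw [show 2 * (j + 1) - 1 = 2 * j + 1 by omega]
    rw [show 2 * j + 1 + 1 = 2 * (j + 1) by ring, hd] at hf
    simp only [Multiset.sum_replicate, Multiset.prod_replicate, Finset.prod_singleton,
      Multiset.count_replicate_self, Fintype.card_fin, smul_eq_mul] at hc
    rw [hf, mul_comm (j + 1) 2, Nat.sub_self, Nat.factorial_zero, one_mul, mul_comm] at hc
    exact Nat.eq_of_mul_eq_mul_left (by positivity) hc

lemma tpowM_mul {n k : ℕ} (g h : Matrix (Fin n) (Fin n) ℝ) :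
    tpowM k g * tpowM k h = tpowM k (g * h) := by
  ext I J
  simp only [tpowM, Matrix.mul_apply, Matrix.of_apply, ← Finset.prod_mul_distrib]
  rw [← Fintype.piFinset_univ, Finset.sum_prod_piFinset Finset.univ
    (fun (r : Fin k) (x : Fin n) => g (I r) x * h x (J r))]

lemma tpowM_one {n k : ℕ} : tpowM k (1 : Matrix (Fin n) (Fin n) ℝ) = 1 := by
  ext I J
  simp only [tpowM, Matrix.of_apply, Matrix.one_apply]
  by_cases h : I = J
  · simp [h]
  · rw [if_neg h]
    obtain ⟨r, hr⟩ := Function.ne_iff.mp h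
    exact Finset.prod_eq_zero (Finset.mem_univ r) (by simp [hr])

/-- the tensor of a linear map -/
def toT (n k l : ℕ) : (((Fin k → Fin n) → ℝ) →ₗ[ℝ] ((Fin l → Fin n) → ℝ)) →ₗ[ℝ]
    ((Fin (l + k) → Fin n) → ℝ) where
  toFun φ := fun C => LinearMap.toMatrix' φ (fun i => C (Fin.castAdd k i)) (fun j => C (Fin.natAdd l j))
  map_add' φ ψ := by ext C; simp
  map_smul' c φ := by ext C; simp

lemma toT_append {n k l : ℕ} (φ : ((Fin k → Fin n) → ℝ) →ₗ[ℝ] ((Fin l → Fin n) → ℝ))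
    (I : Fin l → Fin n) (J : Fin k → Fin n) :
    toT n k l φ (Fin.append I J) = LinearMap.toMatrix' φ I J := by
  simp [toT]

lemma toT_inj {n k l : ℕ} : Function.Injective (toT n k l) := by
  intro φ ψ h
  apply LinearMap.toMatrix'.injective
  ext I J
  rw [← toT_append, ← toT_append, h]

lemma toT_brauer {n k l : ℕ} (β : BrauerPairing (l + k)) :
    toT n k l (brauerMatrix n k l β).mulVecLin = pairT β := by
  funext C
  have : C = Fin.append (fun i => C (Fin.castAdd k i)) (fun j => C (Fin.natAdd l j)) :=
    (Fin.append_castAdd_natAdd (f := C)).symm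
  rw [this, toT_append, ← Matrix.toLin'_apply', LinearMap.toMatrix'_toLin']
  rfl

lemma mem_equiv_iff {n k l : ℕ} (φ : ((Fin k → Fin n) → ℝ) →ₗ[ℝ] ((Fin l → Fin n) → ℝ)) :
    φ ∈ EquivSub k l (fun g : Matrix (Fin n) (Fin n) ℝ => gᵀ * g = 1) ↔ TInv (toT n k l φ) := by
  apply forall_congr'
  intro g
  apply forall_congr'
  intro hg
  have hg' : g * gᵀ = 1 := mul_eq_one_comm.mp hg
  set M := LinearMap.toMatrix' φ with hM
  have h1 : φ ∘ₗ (tpowM k g).mulVecLin = (tpowM l g).mulVecLin ∘ₗ φ ↔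
      M * tpowM k g = tpowM l g * M := by
    rw [← LinearMap.toMatrix'.injective.eq_iff, LinearMap.toMatrix'_comp, LinearMap.toMatrix'_comp,
      ← Matrix.toLin'_apply', ← Matrix.toLin'_apply', LinearMap.toMatrix'_toLin',
      LinearMap.toMatrix'_toLin']
  have e1 : tpowM k g * tpowM k gᵀ = 1 := by rw [tpowM_mul, hg', tpowM_one]
  have e2 : tpowM k gᵀ * tpowM k g = 1 := by rw [tpowM_mul, hg, tpowM_one]
  have h2 : M * tpowM k g = tpowM l g * M ↔ tpowM l g * M * tpowM k gᵀ = M := by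
    constructor
    · intro h; rw [← h, Matrix.mul_assoc, e1, Matrix.mul_one]
    · intro h
      conv_lhs => rw [← h]
      rw [Matrix.mul_assoc, e2, Matrix.mul_one]
  rw [h1, h2]
  have key : ∀ I J, ∑ D : Fin (l + k) → Fin n, (∏ r, g (Fin.append I J r) (D r)) * toT n k l φ D =
      (tpowM l g * M * tpowM k gᵀ) I J := by
    intro I J
    rw [← (Fin.appendEquiv l k).sum_comp, Fintype.sum_prod_type, Matrix.mul_apply, Finset.sum_comm]
    refine Finset.sum_congr rfl fun J' _ => ?_
    rw [Matrix.mul_apply, Finset.sum_mul]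
    refine Finset.sum_congr rfl fun I' _ => ?_
    simp only [Fin.appendEquiv, Equiv.coe_fn_mk, toT_append, Fin.prod_univ_add, Fin.append_left,
      Fin.append_right, tpowM, Matrix.of_apply, Matrix.transpose_apply]
    ring
  constructor
  · intro h C
    rw [← Fin.append_castAdd_natAdd (f := C), key, h, toT_append]
  · intro h
    ext I J
    rw [← key, h, toT_append]

/-- For `l + k` even and `2n ≥ l + k`, the maps `E_β` (over all `(k,l)`-Brauer
partitions `β`) are linearly independent, hence form a basis of
`Hom_{O(n)}((ℝⁿ)^{⊗k}, (ℝⁿ)^{⊗l})`; in particular the dimension of this space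
equals `(l + k - 1)!!`. -/
theorem stmt3 (n k l : ℕ) (hn : 1 ≤ n) (heven : Even (l + k)) (h2n : l + k ≤ 2 * n) :
    LinearIndependent ℝ
      (fun β : BrauerPairing (l + k) => (brauerMatrix n k l β).mulVecLin) ∧
    Submodule.span ℝ
      {φ : ((Fin k → Fin n) → ℝ) →ₗ[ℝ] ((Fin l → Fin n) → ℝ) |
        ∃ β : BrauerPairing (l + k), φ = (brauerMatrix n k l β).mulVecLin}
      = EquivSub k l (fun g => gᵀ * g = 1) ∧
    Module.finrank ℝ (EquivSub (n := n) k l (fun g => gᵀ * g = 1)) =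
      Nat.doubleFactorial (l + k - 1) := by
  have hli : LinearIndependent ℝ
      (fun β : BrauerPairing (l + k) => (brauerMatrix n k l β).mulVecLin) := by
    apply LinearIndependent.of_comp (toT n k l)
    rw [Fintype.linearIndependent_iff]
    intro c hc γ
    have := congrFun hc (lab h2n γ)
    simpa [toT_brauer, pairT_lab] using this
  have hset : {φ : ((Fin k → Fin n) → ℝ) →ₗ[ℝ] ((Fin l → Fin n) → ℝ) |
        ∃ β : BrauerPairing (l + k), φ = (brauerMatrix n k l β).mulVecLin} =
      Set.range (fun β : BrauerPairing (l + k) => (brauerMatrix n k l β).mulVecLin) := by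
    ext φ
    simp [eq_comm]
  have hspan : Submodule.span ℝ
      {φ : ((Fin k → Fin n) → ℝ) →ₗ[ℝ] ((Fin l → Fin n) → ℝ) |
        ∃ β : BrauerPairing (l + k), φ = (brauerMatrix n k l β).mulVecLin}
      = EquivSub k l (fun g => gᵀ * g = 1) := by
    have hle : Submodule.span ℝ
      {φ : ((Fin k → Fin n) → ℝ) →ₗ[ℝ] ((Fin l → Fin n) → ℝ) |
        ∃ β : BrauerPairing (l + k), φ = (brauerMatrix n k l β).mulVecLin}
      ≤ EquivSub k l (fun g => gᵀ * g = 1) := by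
      rw [Submodule.span_le]
      rintro _ ⟨β, rfl⟩
      rw [SetLike.mem_coe, mem_equiv_iff, toT_brauer]
      exact tinv_pairT β
    apply le_antisymm hle
    intro φ hφ
    have hs : (∑ β : BrauerPairing (l + k), toT n k l φ (lab h2n β) •
        (brauerMatrix n k l β).mulVecLin) ∈ Submodule.span ℝ
      {φ : ((Fin k → Fin n) → ℝ) →ₗ[ℝ] ((Fin l → Fin n) → ℝ) |
        ∃ β : BrauerPairing (l + k), φ = (brauerMatrix n k l β).mulVecLin} :=
      Submodule.sum_mem _ fun β _ => Submodule.smul_mem _ _ (Submodule.subset_span ⟨β, rfl⟩)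
    have hd := (mem_equiv_iff _).mp (Submodule.sub_mem _ hφ (hle hs))
    have hz := vanish h2n hd (fun γ => by simp [toT_brauer, pairT_lab])
    have heq : φ - (∑ β : BrauerPairing (l + k), toT n k l φ (lab h2n β) •
        (brauerMatrix n k l β).mulVecLin) = 0 := by
      apply toT_inj
      rw [map_zero]
      funext C
      exact hz C
    rw [sub_eq_zero.mp heq]
    exact hs
  refine ⟨hli, hspan, ?_⟩
  rw [← hspan, hset, finrank_span_eq_card hli, card_pairing _ heven]
end
end

section
/- Let n = 2m ≥ 2 and k, l ≥ 0 be integers with l + k even and n ≥ l + k. Then the maps {F_β : β a (k,l)-Brauer partition} are linearly independent, and hence form a basis of Hom_{Sp(n)}((ℝⁿ)^{⊗k},(ℝⁿ)^{⊗l}); in particular dim Hom_{Sp(n)}((ℝⁿ)^{⊗k},(ℝⁿ)^{⊗l}) = (l+k−1)!!. -/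
open Matrix

noncomputable section

/-- Equivariance for the set of matrices satisfying `P`. -/
def IsGEquiv {n : ℕ} (k l : ℕ) (P : Matrix (Fin n) (Fin n) ℝ → Prop)
    (φ : ((Fin k → Fin n) → ℝ) →ₗ[ℝ] ((Fin l → Fin n) → ℝ)) : Prop :=
  ∀ g : Matrix (Fin n) (Fin n) ℝ, P g →
    φ ∘ₗ (tpowM k g).mulVecLin = (tpowM l g).mulVecLin ∘ₗ φ

/-- The matrix `Ω` of the standard skew-symmetric form in the symplectic basis:
block diagonal with `m` blocks `[[0, 1], [-1, 0]]`.  Its entries are the `ε_{i,j}`. -/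
def OmegaM (n : ℕ) : Matrix (Fin n) (Fin n) ℝ :=
  Matrix.of fun i j =>
    if (i : ℕ) % 2 = 0 ∧ (j : ℕ) = (i : ℕ) + 1 then 1
    else if (j : ℕ) % 2 = 0 ∧ (i : ℕ) = (j : ℕ) + 1 then -1 else 0

/-- The matrix `F_β` of a `(k,l)`-Brauer partition `β` for the symplectic group:
the `(I,J)` entry is `∏_{{p,q} ∈ β, p < q} γ_{c_p, c_q}` where `c = I ⌢ J`, and
`γ_{c_p,c_q}` is `δ_{c_p,c_q}` if `p, q` lie in different rows (exactly one of
them is `< l`), and `ε_{c_p,c_q}` if they lie in the same row. -/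
def sympBrauerMatrix (n k l : ℕ) (β : BrauerPairing (l + k)) :
    Matrix (Fin l → Fin n) (Fin k → Fin n) ℝ :=
  Matrix.of fun I J =>
    ∏ p ∈ Finset.univ.filter (fun p => p < β.pair p),
      if ((p : ℕ) < l ↔ ((β.pair p : Fin (l + k)) : ℕ) < l) then
        OmegaM n (Fin.append I J p) (Fin.append I J (β.pair p))
      else if Fin.append I J p = Fin.append I J (β.pair p) then (1 : ℝ) else 0

set_option linter.unusedSectionVars false


/-- Abstract data of a symplectic basis: partner map and signs. -/
structure SymData (X : Type) where
  st : X → X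
  sg : X → ℝ
  st_st : ∀ x, st (st x) = x
  st_ne : ∀ x, st x ≠ x
  sg_or : ∀ x, sg x = 1 ∨ sg x = -1
  sg_st : ∀ x, sg (st x) = - sg x

section core
variable {X : Type} [Fintype X] [DecidableEq X]

def SymData.Om (S : SymData X) : Matrix X X ℝ :=
  Matrix.of fun i j => if j = S.st i then S.sg i else 0

theorem SymData.Om_apply (S : SymData X) (i j : X) :
    S.Om i j = if j = S.st i then S.sg i else 0 := rfl

/-- Tensor action, with one matrix for each slot. -/
def act {N : ℕ} (B : Fin N → Matrix X X ℝ) :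
    ((Fin N → X) → ℝ) →ₗ[ℝ] ((Fin N → X) → ℝ) where
  toFun f := fun c => ∑ c', (∏ r, B r (c r) (c' r)) * f c'
  map_add' f g := by
    ext c; simp [mul_add, Finset.sum_add_distrib]
  map_smul' a f := by
    ext c; simp [Finset.mul_sum]; congr; ext; ring

theorem act_apply {N : ℕ} (B : Fin N → Matrix X X ℝ) (f : (Fin N → X) → ℝ) (c : Fin N → X) :
    act B f c = ∑ c', (∏ r, B r (c r) (c' r)) * f c' := rfl

theorem act_one {N : ℕ} (f : (Fin N → X) → ℝ) : act (fun _ => (1 : Matrix X X ℝ)) f = f := by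
  ext c
  rw [act_apply, Finset.sum_eq_single c]
  · simp
  · intro b _ hb
    obtain ⟨r, hr⟩ := Function.ne_iff.mp hb
    rw [Finset.prod_eq_zero (Finset.mem_univ r), zero_mul]
    exact Matrix.one_apply_ne (fun h => hr h.symm)
  · simp

theorem act_act {N : ℕ} (B C : Fin N → Matrix X X ℝ) (f : (Fin N → X) → ℝ) :
    act B (act C f) = act (fun r => B r * C r) f := by
  ext c
  simp only [act_apply, Finset.mul_sum, Matrix.mul_apply]
  rw [Finset.sum_comm]
  refine Finset.sum_congr rfl fun d _ => ?_
  rw [Finset.prod_univ_sum]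
  simp only [Fintype.piFinset_univ, Finset.sum_mul, Finset.prod_mul_distrib, mul_assoc]

/-- Product over all vertices equals product over blocks. -/
theorem prod_blocks {N : ℕ} (β : BrauerPairing N) (u : Fin N → ℝ) :
    ∏ r, u r = ∏ p ∈ Finset.univ.filter (fun p => p < β.pair p), (u p * u (β.pair p)) := by
  rw [Finset.prod_mul_distrib, ← Finset.prod_filter_mul_prod_filter_not Finset.univ
    (fun p => p < β.pair p)]
  congr 1
  refine Finset.prod_nbij' β.pair β.pair ?_ ?_ ?_ ?_ ?_
  · intro a ha
    simp only [Finset.mem_filter, Finset.mem_univ, true_and, not_lt] at ha ⊢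
    rw [β.invol]; exact lt_of_le_of_ne ha (β.ne a)
  · intro a ha
    simp only [Finset.mem_filter, Finset.mem_univ, true_and, not_lt] at ha ⊢
    rw [β.invol]; exact ha.le
  · intro a _; exact β.invol a
  · intro a _; exact β.invol a
  · intro a _; rw [β.invol]

/-- Words are the same as families of pairs of letters indexed by blocks. -/
def blockEquiv {N : ℕ} (β : BrauerPairing N) (X : Type) :
    (Fin N → X) ≃ ({p : Fin N // p < β.pair p} → X × X) where
  toFun c b := (c b.1, c (β.pair b.1))
  invFun h p := if hp : p < β.pair p then (h ⟨p, hp⟩).1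
    else (h ⟨β.pair p, by rw [β.invol]; exact lt_of_le_of_ne (not_lt.mp hp) (β.ne p)⟩).2
  left_inv c := by
    ext p
    by_cases hp : p < β.pair p
    · simp [hp]
    · simp [hp, β.invol]
  right_inv h := by
    ext ⟨b, hb⟩
    · simp [hb]
    · simp [β.invol, hb.not_gt]

theorem act_blocks {N : ℕ} (β : BrauerPairing N) (B G : Fin N → Matrix X X ℝ) (c : Fin N → X) :
    act B (fun c' => ∏ p ∈ Finset.univ.filter (fun p => p < β.pair p),
      G p (c' p) (c' (β.pair p))) c =
    ∏ p ∈ Finset.univ.filter (fun p => p < β.pair p),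
      (B p * G p * (B (β.pair p))ᵀ) (c p) (c (β.pair p)) := by
  have h1 : ∀ w : Fin N → ℝ, ∏ p ∈ Finset.univ.filter (fun p => p < β.pair p), w p =
      ∏ b : {p : Fin N // p < β.pair p}, w b.1 := by
    intro w
    exact Finset.prod_subtype _ (by simp) _
  have h2 : ∀ b : Fin N, (B b * G b * (B (β.pair b))ᵀ) (c b) (c (β.pair b)) =
      ∑ z : X × X, B b (c b) z.1 * B (β.pair b) (c (β.pair b)) z.2 * G b z.1 z.2 := by
    intro b
    rw [Fintype.sum_prod_type_right]
    simp only [Matrix.mul_apply, Matrix.transpose_apply, Finset.sum_mul]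
    refine Finset.sum_congr rfl fun _ _ => Finset.sum_congr rfl fun _ _ => by ring
  rw [h1]
  simp only [h2]
  rw [Finset.prod_univ_sum, act_apply, Fintype.piFinset_univ,
    ← Equiv.sum_comp (blockEquiv β X)]
  refine Finset.sum_congr rfl fun d _ => ?_
  rw [prod_blocks β, h1, h1, ← Finset.prod_mul_distrib]
  rfl

/-- The untwisted Brauer function. -/
def fB (S : SymData X) {N : ℕ} (β : BrauerPairing N) : (Fin N → X) → ℝ :=
  fun c => ∏ p ∈ Finset.univ.filter (fun p => p < β.pair p), S.Om (c p) (c (β.pair p))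

def IsInv (S : SymData X) {N : ℕ} (f : (Fin N → X) → ℝ) : Prop :=
  ∀ g : Matrix X X ℝ, gᵀ * S.Om * g = S.Om → act (fun _ => gᵀ) f = f

theorem fB_inv (S : SymData X) {N : ℕ} (β : BrauerPairing N) : IsInv S (fB S β) := by
  intro g hg
  ext c
  unfold fB
  rw [act_blocks β (fun _ => gᵀ) (fun _ => S.Om)]
  simp [hg]

/-- derivation form of invariance -/
theorem derivation_inv {N : ℕ} (f : (Fin N → X) → ℝ) (A : Matrix X X ℝ)
    (h : ∀ a : ℝ, act (fun _ => (1 + a • A)ᵀ) f = f) (w : Fin N → X) :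
    ∑ r, ∑ a, A a (w r) * f (Function.update w r a) = 0 := by
  have hd : HasDerivAt (fun a : ℝ => act (fun _ => (1 + a • A)ᵀ) f w)
      (∑ c', (∑ r, (∏ j ∈ Finset.univ.erase r, (1 : Matrix X X ℝ) (c' j) (w j)) •
        A (c' r) (w r)) * f c') 0 := by
    simp only [act_apply]
    refine HasDerivAt.fun_sum fun c' _ => ?_
    refine HasDerivAt.mul_const ?_ _
    have := HasDerivAt.fun_finsetProd (u := (Finset.univ : Finset (Fin N))) (x := (0 : ℝ))
      (f := fun r a => (1 + a • A)ᵀ (w r) (c' r)) (f' := fun r => A (c' r) (w r)) (by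
        intro r _
        simp only [Matrix.transpose_apply, Matrix.add_apply, Matrix.smul_apply, smul_eq_mul]
        simpa using ((hasDerivAt_id (0 : ℝ)).mul_const (A (c' r) (w r))).const_add
          ((1 : Matrix X X ℝ) (c' r) (w r)))
    simpa using this
  have hc : HasDerivAt (fun a : ℝ => act (fun _ => (1 + a • A)ᵀ) f w) 0 0 := by
    simp only [h]
    exact hasDerivAt_const _ _
  refine Eq.trans ?_ (hd.unique hc)
  simp only [Finset.sum_mul]
  conv_rhs => rw [Finset.sum_comm]
  refine Finset.sum_congr rfl fun r _ => ?_
  refine Finset.sum_of_injOn (fun a => Function.update w r a) ?_ ?_ ?_ ?_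
  · intro a _ b _ hab
    exact Function.update_injective w r hab
  · simp
  · intro d _ hd
    have : ∃ j, j ≠ r ∧ d j ≠ w j := by
      by_contra! hcon
      apply hd
      refine ⟨d r, by simp, ?_⟩
      ext j
      by_cases hj : j = r
      · subst hj; simp
      · simp [hj, hcon j hj]
    obtain ⟨j, hj, hjw⟩ := this
    have hz : ∏ j ∈ Finset.univ.erase r, (1 : Matrix X X ℝ) (d j) (w j) = 0 :=
      Finset.prod_eq_zero (i := j) (by simp [hj]) (Matrix.one_apply_ne hjw)
    rw [hz]
    simp
  · intro a _
    have : ∏ j ∈ Finset.univ.erase r, (1 : Matrix X X ℝ) (Function.update w r a j) (w j) = 1 := by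
      refine Finset.prod_eq_one fun j hj => ?_
      rw [Function.update_of_ne (Finset.ne_of_mem_erase hj), Matrix.one_apply_eq]
    rw [this]; simp

theorem Om_mul_apply (S : SymData X) (A : Matrix X X ℝ) (i j : X) :
    (S.Om * A) i j = S.sg i * A (S.st i) j := by
  simp [Matrix.mul_apply, S.Om_apply]

theorem mul_Om_apply (S : SymData X) (A : Matrix X X ℝ) (i j : X) :
    (A * S.Om) i j = - (S.sg j * A i (S.st j)) := by
  have : ∀ x, (j = S.st x) = (x = S.st j) := by
    intro x; apply propext; constructor
    · rintro rfl; rw [S.st_st]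
    · rintro rfl; rw [S.st_st]
  simp [Matrix.mul_apply, S.Om_apply, this, S.sg_st]
  ring

/-- monomial matrices -/
def monoM (σ : X → X) (η : X → ℝ) : Matrix X X ℝ :=
  Matrix.of fun a b => if a = σ b then η b else 0

theorem monoM_symp (S : SymData X) (σ : X → X) (η : X → ℝ) (hσ : Function.Injective σ)
    (hst : ∀ x, σ (S.st x) = S.st (σ x)) (hη : ∀ x, η x * η (S.st x) * S.sg (σ x) = S.sg x) :
    (monoM σ η)ᵀ * S.Om * monoM σ η = S.Om := by
  ext i j
  rw [Matrix.mul_assoc, Matrix.mul_apply]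
  simp only [Om_mul_apply]
  simp only [Matrix.transpose_apply, monoM, Matrix.of_apply, ite_mul, zero_mul,
    Finset.sum_ite_eq', Finset.mem_univ, if_true, S.Om_apply]
  rw [← hst]
  by_cases h : j = S.st i
  · subst h
    simp only [if_true, ← hη i]
    ring
  · have : σ (S.st i) ≠ σ j := fun h' => h (hσ h').symm
    simp [h, this]

theorem act_monoM (σ : X → X) (η : X → ℝ) {N : ℕ} (f : (Fin N → X) → ℝ) (c : Fin N → X) :
    act (fun _ => (monoM σ η)ᵀ) f c = (∏ r, η (c r)) * f (σ ∘ c) := by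
  rw [act_apply, Finset.sum_eq_single (σ ∘ c)]
  · simp [monoM]
  · intro b _ hb
    obtain ⟨r, hr⟩ := Function.ne_iff.mp hb
    rw [Finset.prod_eq_zero (Finset.mem_univ r), zero_mul]
    simp only [Function.comp] at hr
    simp [monoM, hr]
  · simp

theorem weight_zero (S : SymData X) {N : ℕ} (f : (Fin N → X) → ℝ) (hf : IsInv S f)
    (c : Fin N → X) (hc : f c ≠ 0) (x : X) :
    (Finset.univ.filter (fun r => c r = x)).card =
      (Finset.univ.filter (fun r => c r = S.st x)).card := by
  have hx := S.st_ne x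
  have hx2 := S.st_st x
  let η : X → ℝ := fun z => (if z = x then 2 else 1) * (if z = S.st x then 2⁻¹ else 1)
  have h1 := congrFun (hf (monoM id η) (monoM_symp S id η Function.injective_id (fun _ => rfl)
    (by
      intro z
      have hz := S.st_ne z
      have e1 : (S.st z = x) = (z = S.st x) := by
        apply propext; constructor
        · rintro rfl; rw [S.st_st]
        · rintro rfl; rw [S.st_st]
      have e2 : (S.st z = S.st x) = (z = x) := by
        apply propext; constructor
        · intro h; rw [← S.st_st z, h, S.st_st]
        · rintro rfl; rfl
      simp only [η, id, e1, e2]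
      by_cases h3 : z = x <;> by_cases h4 : z = S.st x <;>
        simp only [h3, h4, if_true, if_false] <;> simp [hx, hx.symm]))) c
  rw [act_monoM] at h1
  have h2 : ∏ r, η (c r) = 1 := by
    have : (∏ r, η (c r) - 1) * f c = 0 := by
      rw [sub_mul, one_mul, sub_eq_zero]; exact h1
    rcases mul_eq_zero.mp this with h | h
    · linarith
    · exact absurd h hc
  simp only [η, Finset.prod_mul_distrib, Finset.prod_ite, Finset.prod_const, one_pow, mul_one,
    inv_pow] at h2
  have h3 : (2 : ℝ) ^ (Finset.univ.filter (fun r => c r = x)).card =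
      2 ^ (Finset.univ.filter (fun r => c r = S.st x)).card := by
    field_simp at h2
    linarith
  exact pow_right_injective₀ (by norm_num) (by norm_num) h3

def uniA (S : SymData X) (x y : X) : Matrix X X ℝ :=
  Matrix.of fun a b => (if a = y ∧ b = x then 1 else 0) +
    (if a = S.st x ∧ b = S.st y then - (S.sg x * S.sg y) else 0)

theorem uniA_symp (S : SymData X) (x y : X) (h1 : y ≠ x) (h2 : y ≠ S.st x) (a : ℝ) :
    (1 + a • uniA S x y)ᵀ * S.Om * (1 + a • uniA S x y) = S.Om := by
  have hst : ∀ p q, S.st p = q ↔ p = S.st q := by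
    intro p q; constructor
    · rintro rfl; rw [S.st_st]
    · rintro rfl; rw [S.st_st]
  have e1 : (uniA S x y)ᵀ * S.Om + S.Om * uniA S x y = 0 := by
    ext i j
    rw [Matrix.add_apply, mul_Om_apply, Om_mul_apply]
    simp only [Matrix.transpose_apply, uniA, Matrix.of_apply, hst, S.st_st, Matrix.zero_apply]
    have hsx : S.sg x * S.sg x = 1 := by rcases S.sg_or x with h | h <;> rw [h] <;> norm_num
    have hsy := S.sg_st y
    have hxy : x ≠ S.st y := by
      intro h; apply h2; rw [h, S.st_st]
    by_cases hi : i = x <;> by_cases hj : j = x <;> by_cases hi' : i = S.st y <;>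
      by_cases hj' : j = S.st y <;> simp_all <;>
        first | linear_combination (S.sg y) * hsx | linear_combination - (S.sg y) * hsx
  have e2 : (uniA S x y)ᵀ * (S.Om * uniA S x y) = 0 := by
    ext i j
    rw [Matrix.mul_apply]
    refine Finset.sum_eq_zero fun b _ => ?_
    rw [Om_mul_apply]
    simp only [Matrix.transpose_apply, uniA, Matrix.of_apply, hst, S.st_st]
    have hy := S.st_ne y
    have hx := S.st_ne x
    have hxy : S.st x ≠ S.st y := by
      intro h; apply h1; rw [← S.st_st y, ← h, S.st_st]
    by_cases hb : b = y
    · subst hb; simp [h1, h2, hy.symm]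
    · by_cases hb' : b = S.st x
      · subst hb'; simp [hxy, hx]
      · simp [hb, hb']
  have : (1 + a • uniA S x y)ᵀ * S.Om * (1 + a • uniA S x y) =
      S.Om + a • ((uniA S x y)ᵀ * S.Om + S.Om * uniA S x y) +
        (a * a) • ((uniA S x y)ᵀ * (S.Om * uniA S x y)) := by
    simp only [Matrix.transpose_add, Matrix.transpose_one, Matrix.transpose_smul,
      Matrix.add_mul, Matrix.mul_add, Matrix.one_mul, Matrix.mul_one, Matrix.smul_mul,
      Matrix.mul_smul, smul_add, smul_smul, Matrix.mul_assoc]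
    abel
  rw [this, e1, e2]; simp

/-- The reduction identity. -/
theorem reduction (S : SymData X) {N : ℕ} (f : (Fin N → X) → ℝ) (hf : IsInv S f)
    (c : Fin N → X) (x y : X) (hy : ∀ r, c r ≠ y) (hy' : ∀ r, c r ≠ S.st y)
    (q : Fin N) (hq : c q = S.st x)
    (h1 : y ≠ x) (h2 : y ≠ S.st x)
    (h0 : ∀ r, c r = x → f (Function.update (Function.update c q (S.st y)) r y) = 0) :
    f c = 0 := by
  have key := derivation_inv f (uniA S x y) (fun a => hf _ (uniA_symp S x y h1 h2 a))
    (Function.update c q (S.st y))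
  rw [Finset.sum_eq_single q] at key
  · rw [Finset.sum_eq_single (S.st x)] at key
    · have e : Function.update (Function.update c q (S.st y)) q (S.st x) = c := by
        rw [Function.update_idem, ← hq, Function.update_eq_self]
      have hne : S.st x ≠ y := h2.symm
      have hsx := S.sg_or x
      have hsy := S.sg_or y
      rw [e] at key
      simp only [uniA, Matrix.of_apply, Function.update_self, hne, false_and, if_false,
        and_self, if_true, zero_add] at key
      rcases hsx with h | h <;> rcases hsy with h' | h' <;> rw [h, h'] at key <;> linarith
    · intro b _ hb
      have : S.st y ≠ x := by
        intro h; apply h2; rw [← h, S.st_st]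
      simp [uniA, hb, this]
    · simp
  · intro r _ hr
    refine Finset.sum_eq_zero fun b _ => ?_
    have e : Function.update c q (S.st y) r = c r := by simp [hr]
    rw [e]
    simp only [uniA, Matrix.of_apply, hy' r, and_false, if_false, add_zero]
    by_cases hb : b = y ∧ c r = x
    · rw [hb.1, h0 r hb.2, mul_zero]
    · simp [hb]
  · simp

/-- An invariant vanishing on injective words vanishes. -/
theorem zero_of_injective (S : SymData X) {N : ℕ} (hN : N ≤ Fintype.card X)
    (f : (Fin N → X) → ℝ) (hf : IsInv S f)
    (h0 : ∀ c : Fin N → X, Function.Injective c → f c = 0) (c : Fin N → X) : f c = 0 := by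
  induction hM : Fintype.card X - (Finset.univ.image c).card using Nat.strong_induction_on
    generalizing c with
  | _ M ih =>
  by_contra hfc
  have hw := weight_zero S f hf c hfc
  have hinj : ¬ Function.Injective c := fun h => hfc (h0 c h)
  have hnot : ¬ Function.Surjective c := by
    intro hs
    exact hinj ((Fintype.bijective_iff_surjective_and_card c).mpr
      ⟨hs, le_antisymm (by simpa using hN) (Fintype.card_le_of_surjective c hs)⟩).1
  have hy : ∃ y, ∀ r, c r ≠ y := by
    simpa [Function.Surjective] using hnot
  obtain ⟨y, hy⟩ := hy
  have hy' : ∀ r, c r ≠ S.st y := by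
    have h3 := hw y
    have : (Finset.univ.filter (fun r => c r = y)) = ∅ := by simp [hy]
    rw [this, Finset.card_empty, eq_comm, Finset.card_eq_zero] at h3
    intro r hr
    have : r ∈ Finset.univ.filter (fun r => c r = S.st y) := by simp [hr]
    rw [h3] at this; simp at this
  have hx : ∃ p p', p ≠ p' ∧ c p = c p' := by
    simp only [Function.Injective, not_forall] at hinj
    obtain ⟨p, p', h, hne⟩ := hinj
    exact ⟨p, p', hne, h⟩
  obtain ⟨p, p', hpp, hcp⟩ := hx
  have hx2 : 1 < (Finset.univ.filter (fun r => c r = S.st (c p))).card := by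
    rw [← hw (c p), Finset.one_lt_card]
    exact ⟨p, by simp, p', by simp [hcp], hpp⟩
  obtain ⟨q, hq, q', hq', hqq⟩ := Finset.one_lt_card.mp hx2
  simp only [Finset.mem_filter, Finset.mem_univ, true_and] at hq hq'
  have hxs := S.st_ne (c p)
  have hys := S.st_ne y
  refine hfc (reduction S f hf c (c p) y hy hy' q hq (hy p).symm (by rw [← hq]; exact (hy q).symm) ?_)
  intro r hr
  refine ih _ ?_ _ rfl
  have hrq : r ≠ q := by rintro rfl; rw [hq] at hr; exact hxs hr
  have hlt : (Finset.univ.image c).card < (Finset.univ.image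
      (Function.update (Function.update c q (S.st y)) r y)).card := by
    apply Finset.card_lt_card
    rw [Finset.ssubset_iff_of_subset]
    · refine ⟨y, ?_, ?_⟩
      · simp only [Finset.mem_image, Finset.mem_univ, true_and]
        exact ⟨r, by simp⟩
      · simp [hy]
    · intro z hz
      simp only [Finset.mem_image, Finset.mem_univ, true_and] at hz ⊢
      obtain ⟨t, rfl⟩ := hz
      by_cases ht : c t = c p
      · by_cases hrp : r = p
        · refine ⟨p', ?_⟩
          have a1 : p' ≠ r := by rw [hrp]; exact hpp.symm
          have a2 : p' ≠ q := by rintro rfl; rw [hq] at hcp; exact hxs hcp.symm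
          simp [a1, a2, ht, hcp]
        · refine ⟨p, ?_⟩
          have a1 : p ≠ r := fun h => hrp h.symm
          have a2 : p ≠ q := by rintro rfl; exact hxs hq.symm
          simp [a1, a2, ht]
      · by_cases ht' : c t = S.st (c p)
        · refine ⟨q', ?_⟩
          have a1 : q' ≠ r := by rintro rfl; rw [hr] at hq'; exact hxs hq'.symm
          simp [a1, hqq.symm, ht', hq']
        · refine ⟨t, ?_⟩
          have a1 : t ≠ r := by rintro rfl; exact ht hr
          have a2 : t ≠ q := by rintro rfl; exact ht' hq
          simp [a1, a2]
  have hle : (Finset.univ.image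
      (Function.update (Function.update c q (S.st y)) r y)).card ≤ Fintype.card X :=
    Finset.card_le_univ _
  omega

/-- `c` labels the blocks of `β` by distinct symplectic pairs. -/
def Compat (S : SymData X) {N : ℕ} (c : Fin N → X) (β : BrauerPairing N) : Prop :=
  Function.Injective c ∧ ∀ p, c (β.pair p) = S.st (c p)

theorem exists_pairing (S : SymData X) {N : ℕ} (f : (Fin N → X) → ℝ) (hf : IsInv S f)
    (c : Fin N → X) (hc : Function.Injective c) (hfc : f c ≠ 0) :
    ∃ β : BrauerPairing N, Compat S c β := by
  have h : ∀ p, ∃ q, c q = S.st (c p) := by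
    intro p
    have h1 := weight_zero S f hf c hfc (c p)
    have h2 : 0 < (Finset.univ.filter (fun r => c r = c p)).card :=
      Finset.card_pos.mpr ⟨p, by simp⟩
    rw [h1] at h2
    obtain ⟨q, hq⟩ := Finset.card_pos.mp h2
    exact ⟨q, by simpa using hq⟩
  choose b hb using h
  refine ⟨⟨b, ?_, ?_⟩, hc, hb⟩
  · intro p; apply hc; rw [hb, hb, S.st_st]
  · intro p h; have := hb p; rw [h] at this; exact S.st_ne _ this.symm

theorem BrauerPairing.ext' {N : ℕ} {β β' : BrauerPairing N} (h : ∀ p, β.pair p = β'.pair p) :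
    β = β' := by
  cases β; cases β'
  congr
  exact funext h

theorem fB_self (S : SymData X) {N : ℕ} (c : Fin N → X) (β : BrauerPairing N)
    (h : Compat S c β) : fB S β c ≠ 0 := by
  unfold fB
  rw [Finset.prod_ne_zero_iff]
  intro p _
  rw [h.2, S.Om_apply, if_pos rfl]
  rcases S.sg_or (c p) with h | h <;> rw [h] <;> norm_num

theorem fB_ne (S : SymData X) {N : ℕ} (c : Fin N → X) (β β' : BrauerPairing N)
    (h : Compat S c β) (hne : β' ≠ β) : fB S β' c = 0 := by
  by_contra h0
  have h0 := Finset.prod_ne_zero_iff.mp (show _ ≠ _ from h0)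
  have h1 : ∀ p, p < β'.pair p → β'.pair p = β.pair p := by
    intro p hp
    have := h0 p (by simp [hp])
    rw [S.Om_apply] at this
    have h2 : c (β'.pair p) = S.st (c p) := by
      by_contra h3; simp [h3] at this
    exact h.1 (h2.trans (h.2 p).symm)
  apply hne
  apply BrauerPairing.ext'
  intro p
  by_cases hp : p < β'.pair p
  · exact h1 p hp
  · have h2 : β'.pair p < p := lt_of_le_of_ne (not_lt.mp hp) (β'.ne p)
    have h3 := h1 (β'.pair p) (by rw [β'.invol]; exact h2)
    rw [β'.invol] at h3
    conv_rhs => rw [h3]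
    rw [β.invol]

/-- symplectic transposition -/
def sswap (S : SymData X) (x y : X) : X → X := fun z =>
  if z = x then y else if z = S.st x then S.st y else
    if z = y then x else if z = S.st y then S.st x else z

theorem sswap_invol (S : SymData X) (x y z : X) : sswap S x y (sswap S x y z) = z := by
  have h1 := S.st_st
  have h2 := S.st_ne
  unfold sswap
  grind

theorem sswap_st (S : SymData X) (x y z : X) :
    sswap S x y (S.st z) = S.st (sswap S x y z) := by
  have h1 := S.st_st
  have h2 := S.st_ne
  unfold sswap
  grind

theorem f_comp_zero (S : SymData X) {N : ℕ} (f : (Fin N → X) → ℝ) (hf : IsInv S f)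
    (x y : X) (c : Fin N → X) (h : f (sswap S x y ∘ c) = 0) : f c = 0 := by
  let σ := sswap S x y
  let η : X → ℝ := fun z => if S.sg z = 1 then 1 else S.sg (σ z) * S.sg z
  have hη : ∀ z, η z * η (S.st z) * S.sg (σ z) = S.sg z := by
    intro z
    simp only [η, σ, sswap_st, S.sg_st]
    rcases S.sg_or z with h | h <;> rcases S.sg_or (sswap S x y z) with h' | h' <;>
      rw [h, h'] <;> norm_num
  have h1 := congrFun (hf (monoM σ η) (monoM_symp S σ η
    (Function.Involutive.injective (sswap_invol S x y)) (sswap_st S x y) hη)) c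
  rw [act_monoM] at h1
  rw [← h1]
  simp [σ, h]

theorem compat_transfer (S : SymData X) {N : ℕ} (f : (Fin N → X) → ℝ) (hf : IsInv S f)
    (β : BrauerPairing N) (c' : Fin N → X) (hc' : Compat S c' β) (h0 : f c' = 0)
    (c : Fin N → X) (hc : Compat S c β) : f c = 0 := by
  induction hM : (Finset.univ.filter (fun p => c p ≠ c' p)).card using Nat.strong_induction_on
    generalizing c with
  | _ M ih =>
  by_cases hall : ∀ p, c p = c' p
  · rw [funext hall]; exact h0
  push Not at hall
  obtain ⟨p, hp⟩ := hall
  apply f_comp_zero S f hf (c p) (c' p)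
  refine ih _ ?_ _ ?_ rfl
  · rw [← hM]
    apply Finset.card_lt_card
    rw [Finset.ssubset_iff_of_subset]
    · refine ⟨p, by simp [hp], ?_⟩
      simp only [Finset.mem_filter, Finset.mem_univ, true_and, not_not]
      simp [sswap]
    · intro r hr
      simp only [Finset.mem_filter, Finset.mem_univ, true_and] at hr ⊢
      intro heq
      apply hr
      simp only [Function.comp]
      by_cases h1 : c r = c p
      · rw [hc.1 h1]; simp [sswap]
      by_cases h2 : c r = S.st (c p)
      · rw [← hc.2] at h2
        rw [hc.1 h2, hc.2, hc'.2, sswap_st]; simp [sswap]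
      have h3 : c r ≠ c' p := by
        intro h; rw [heq] at h; apply h1; rw [hc'.1 h]
      have h4 : c r ≠ S.st (c' p) := by
        intro h; rw [heq, ← hc'.2] at h; apply h2; rw [hc'.1 h, hc.2]
      simp only [sswap, h1, h2, h3, h4, if_false]
      exact heq
  · refine ⟨(Function.Involutive.injective (sswap_invol S _ _)).comp hc.1, ?_⟩
    intro q
    simp only [Function.comp, hc.2, sswap_st]

theorem card_half {Y : Type} [Fintype Y] (P : Y → Prop) [DecidablePred P] (τ : Y → Y)
    (hτ : ∀ y, τ (τ y) = y) (hP : ∀ y, P (τ y) ↔ ¬ P y) :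
    2 * Fintype.card {y // P y} = Fintype.card Y := by
  have h1 := Fintype.card_subtype_compl P
  have h2 : Fintype.card {y // P y} = Fintype.card {y // ¬ P y} := by
    refine Fintype.card_congr ⟨fun y => ⟨τ y.1, ?_⟩, fun y => ⟨τ y.1, ?_⟩, ?_, ?_⟩
    · rw [hP, not_not]; exact y.2
    · rw [hP]; exact y.2
    · intro y; simp [hτ]
    · intro y; simp [hτ]
  have h3 := Fintype.card_subtype_le P
  omega

theorem exists_word (S : SymData X) {N : ℕ} (hN : N ≤ Fintype.card X) (β : BrauerPairing N) :
    ∃ c : Fin N → X, Compat S c β := by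
  classical
  have h1 := card_half (fun p : Fin N => p < β.pair p) β.pair β.invol (by
    intro p
    rw [β.invol, not_lt]
    exact ⟨le_of_lt, fun h => lt_of_le_of_ne h (β.ne p)⟩)
  have h2 := card_half (fun x : X => S.sg x = 1) S.st S.st_st (by
    intro x
    rw [S.sg_st]
    rcases S.sg_or x with h | h <;> rw [h] <;> norm_num)
  rw [Fintype.card_fin] at h1
  obtain ⟨b⟩ := Function.Embedding.nonempty_of_card_le
    (show Fintype.card {p : Fin N // p < β.pair p} ≤ Fintype.card {x : X // S.sg x = 1} by omega)
  have hlt : ∀ p, ¬ p < β.pair p → β.pair p < β.pair (β.pair p) := fun p hp => by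
    rw [β.invol]; exact lt_of_le_of_ne (not_lt.mp hp) (β.ne p)
  let c : Fin N → X := fun p => if hp : p < β.pair p then (b ⟨p, hp⟩).1
    else S.st (b ⟨β.pair p, hlt p hp⟩).1
  have hst : ∀ p, c (β.pair p) = S.st (c p) := by
    intro p
    by_cases hp : p < β.pair p
    · have : ¬ β.pair p < β.pair (β.pair p) := by rw [β.invol]; exact hp.not_gt
      simp only [c, this, hp, dif_pos, dif_neg, not_false_eq_true]
      simp only [β.invol]
    · simp only [c, hp, hlt p hp, dif_pos, dif_neg, not_false_eq_true, S.st_st]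
  have hsg : ∀ p, p < β.pair p ↔ S.sg (c p) = 1 := by
    intro p
    by_cases hp : p < β.pair p
    · simp only [c, hp, dif_pos, true_iff]
      exact (b _).2
    · simp only [c, hp, dif_neg, not_false_eq_true, false_iff, S.sg_st]
      rw [(b _).2]; norm_num
  have hinj1 : ∀ p q, p < β.pair p → q < β.pair q → c p = c q → p = q := by
    intro p q hp hq h
    simp only [c, hp, hq, dif_pos] at h
    have := b.injective (Subtype.ext h)
    exact congrArg Subtype.val this
  refine ⟨c, ?_, hst⟩
  intro p q h
  by_cases hp : p < β.pair p
  · have hq : q < β.pair q := by rw [hsg, ← h, ← hsg]; exact hp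
    exact hinj1 p q hp hq h
  · have hq : ¬ q < β.pair q := by rw [hsg, ← h, ← hsg]; exact hp
    have := hinj1 (β.pair p) (β.pair q) (hlt p hp) (hlt q hq) (by rw [hst, hst, h])
    rw [← β.invol p, this, β.invol]

instance inst_s7 {N : ℕ} : Finite (BrauerPairing N) :=
  Finite.of_injective BrauerPairing.pair (fun _ _ h => BrauerPairing.ext' (congrFun h))

instance inst_s7_2 {N : ℕ} : Fintype (BrauerPairing N) := Fintype.ofFinite _

theorem fB_linInd (S : SymData X) {N : ℕ} (hN : N ≤ Fintype.card X) :
    LinearIndependent ℝ (fun β : BrauerPairing N => fB S β) := by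
  rw [Fintype.linearIndependent_iff]
  intro a ha β
  obtain ⟨c, hc⟩ := exists_word S hN β
  have h := congrFun ha c
  simp only [Finset.sum_apply, Pi.smul_apply, smul_eq_mul, Pi.zero_apply] at h
  rw [Finset.sum_eq_single β] at h
  · exact (mul_eq_zero.mp h).resolve_right (fB_self S c β hc)
  · intro β' _ hne
    rw [fB_ne S c β β' hc hne, mul_zero]
  · simp

theorem IsInv.sub_sum (S : SymData X) {N : ℕ} (f : (Fin N → X) → ℝ) (hf : IsInv S f)
    (a : BrauerPairing N → ℝ) : IsInv S (f - ∑ β, a β • fB S β) := by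
  intro g hg
  rw [map_sub, map_sum, hf g hg]
  congr 1
  refine Finset.sum_congr rfl fun β _ => ?_
  rw [map_smul, fB_inv S β g hg]

/-- First fundamental theorem in the stable range. -/
theorem inv_eq_sum (S : SymData X) {N : ℕ} (hN : N ≤ Fintype.card X)
    (f : (Fin N → X) → ℝ) (hf : IsInv S f) :
    ∃ a : BrauerPairing N → ℝ, f = ∑ β, a β • fB S β := by
  choose w hw using exists_word S hN (N := N)
  let a : BrauerPairing N → ℝ := fun β => f (w β) / fB S β (w β)
  refine ⟨a, ?_⟩
  have hg := IsInv.sub_sum S f hf a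
  set g := f - ∑ β, a β • fB S β with hgdef
  have h1 : ∀ β, g (w β) = 0 := by
    intro β
    simp only [hgdef, Pi.sub_apply, Finset.sum_apply, Pi.smul_apply, smul_eq_mul]
    rw [Finset.sum_eq_single β]
    · simp only [a]
      rw [div_mul_cancel₀ _ (fB_self S _ β (hw β)), sub_self]
    · intro β' _ hne
      rw [fB_ne S _ β β' (hw β) hne, mul_zero]
    · simp
  have h2 : ∀ c, g c = 0 := by
    refine zero_of_injective S hN g hg ?_
    intro c hc
    by_contra h
    obtain ⟨β, hβ⟩ := exists_pairing S g hg c hc h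
    exact h (compat_transfer S g hg β (w β) (hw β) (h1 β) c hβ)
  have h3 : g = 0 := funext h2
  exact sub_eq_zero.mp h3

end core

theorem card_brauer (r : ℕ) :
    Fintype.card (BrauerPairing (2 * r)) = Nat.doubleFactorial (2 * r - 1) := by
  classical
  have h1 : Fintype.card (BrauerPairing (2 * r)) = (Finset.univ.filter
      (fun g : Equiv.Perm (Fin (2 * r)) => g.cycleType = Multiset.replicate r 2)).card := by
    rw [← Fintype.card_subtype]
    have key : ∀ g : Equiv.Perm (Fin (2 * r)), g.cycleType = Multiset.replicate r 2 ↔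
        (∀ p, g (g p) = p) ∧ ∀ p, g p ≠ p := by
      intro g
      constructor
      · intro h
        have h2 : g ^ 2 = 1 := by
          rw [← orderOf_dvd_iff_pow_eq_one, ← Equiv.Perm.lcm_cycleType, h, Multiset.lcm_dvd]
          intro b hb
          rw [Multiset.eq_of_mem_replicate hb]
        have h3 : g.support.card = 2 * r := by
          rw [← Equiv.Perm.sum_cycleType, h]; simp [mul_comm]
        have h4 : g.support = Finset.univ := by
          rw [← Finset.card_eq_iff_eq_univ, h3, Fintype.card_fin]
        refine ⟨fun p => ?_, fun p => ?_⟩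
        · have := congrArg (fun e : Equiv.Perm (Fin (2 * r)) => e p) h2
          simpa [pow_two] using this
        · rw [← Equiv.Perm.mem_support, h4]; simp
      · rintro ⟨h2, h3⟩
        have h4 : g ^ 2 = 1 := by
          ext p; simp [pow_two, h2]
        have h5 : ∀ b ∈ g.cycleType, b = 2 := by
          intro b hb
          have h6 := Equiv.Perm.dvd_of_mem_cycleType hb
          have h7 := Equiv.Perm.two_le_of_mem_cycleType hb
          have h8 : b ∣ 2 := h6.trans (orderOf_dvd_of_pow_eq_one h4)
          exact le_antisymm (Nat.le_of_dvd (by norm_num) h8) h7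
        have h9 := Multiset.eq_replicate_card.mpr h5
        have h10 : g.support.card = 2 * r := by
          have : g.support = Finset.univ := by
            ext p; simp [h3]
          rw [this]; simp
        rw [← Equiv.Perm.sum_cycleType, h9] at h10
        simp only [Multiset.sum_replicate, smul_eq_mul] at h10
        rw [h9]
        congr 1
        omega
    refine Fintype.card_congr ⟨fun β => ⟨⟨β.pair, β.pair, β.invol, β.invol⟩, ?_⟩,
      fun g => ⟨g.1, ((key g.1).mp g.2).1, ((key g.1).mp g.2).2⟩, ?_, ?_⟩
    · rw [key]; exact ⟨β.invol, β.ne⟩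
    · intro β; rfl
    · intro g; ext; rfl
  rw [h1]
  have h2 := Equiv.Perm.card_of_cycleType_mul_eq (Fin (2 * r)) (Multiset.replicate r 2)
  rw [if_pos] at h2
  · have h3 : ∏ n ∈ (Multiset.replicate r 2).toFinset,
        ((Multiset.replicate r 2).count n).factorial = r.factorial := by
      rcases Nat.eq_zero_or_pos r with rfl | hr
      · simp
      · rw [Multiset.toFinset_replicate, if_neg hr.ne']; simp
    rw [h3] at h2
    simp only [Fintype.card_fin, Multiset.sum_replicate, smul_eq_mul, Multiset.prod_replicate,
      mul_comm r 2, Nat.sub_self, Nat.factorial_zero, one_mul] at h2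
    have h4 : (2 * r).factorial = Nat.doubleFactorial (2 * r - 1) * (2 ^ r * r.factorial) := by
      rw [← Nat.doubleFactorial_two_mul]
      rcases r with _ | s
      · simp
      · have := Nat.factorial_eq_mul_doubleFactorial (2 * s + 1)
        rw [mul_comm (Nat.doubleFactorial _)] at this
        exact this
    rw [h4] at h2
    exact Nat.eq_of_mul_eq_mul_right (by positivity) h2
  · refine ⟨by simp [mul_comm], ?_⟩
    intro a ha
    rw [Multiset.eq_of_mem_replicate ha]

/-- The concrete symplectic data on `Fin (2 * m)`. -/
def finSym (m : ℕ) : SymData (Fin (2 * m)) where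
  st i := if h : (i : ℕ) % 2 = 0 then ⟨i + 1, by have := i.2; omega⟩
    else ⟨i - 1, by have := i.2; omega⟩
  sg i := if (i : ℕ) % 2 = 0 then 1 else -1
  st_st i := by
    apply Fin.ext
    by_cases h : (i : ℕ) % 2 = 0
    · have h' : ¬ ((i : ℕ) + 1) % 2 = 0 := by omega
      simp [h, h']
    · have h' : ((i : ℕ) - 1) % 2 = 0 := by omega
      simp [h, h']; omega
  st_ne i := by
    rw [Ne, Fin.ext_iff]
    by_cases h : (i : ℕ) % 2 = 0
    · simp [h]
    · simp [h]; omega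
  sg_or i := by
    by_cases h : (i : ℕ) % 2 = 0 <;> simp [h]
  sg_st i := by
    by_cases h : (i : ℕ) % 2 = 0
    · have h' : ¬ ((i : ℕ) + 1) % 2 = 0 := by omega
      simp [h, h']
    · have h' : ((i : ℕ) - 1) % 2 = 0 := by omega
      simp [h, h']

theorem finSym_Om (m : ℕ) : (finSym m).Om = OmegaM (2 * m) := by
  ext i j
  simp only [SymData.Om_apply, finSym, OmegaM, Matrix.of_apply]
  by_cases h : (i : ℕ) % 2 = 0
  · have h1 : ¬ ((j : ℕ) % 2 = 0 ∧ (i : ℕ) = (j : ℕ) + 1) := by omega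
    simp [h, h1, Fin.ext_iff]
  · have h1 : ((j : ℕ) % 2 = 0 ∧ (i : ℕ) = (j : ℕ) + 1) ↔ (j : ℕ) = i - 1 := by omega
    simp [h, h1, Fin.ext_iff]

section transfer
variable {X : Type} [Fintype X] [DecidableEq X]

theorem Om_Omt (S : SymData X) : S.Om * S.Omᵀ = 1 := by
  ext i j
  rw [Om_mul_apply, Matrix.transpose_apply, S.Om_apply, Matrix.one_apply]
  by_cases h : i = j
  · subst h
    rcases S.sg_or i with h | h <;> simp [h]
  · have : S.st i ≠ S.st j := by
      intro h'; apply h; rw [← S.st_st i, h', S.st_st]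
    simp [h, this]

/-- Matrix `A` in the first `l` slots and `B` in the last `k`. -/
def twoB (l k : ℕ) (A B : Matrix X X ℝ) : Fin (l + k) → Matrix X X ℝ :=
  fun r => if (r : ℕ) < l then A else B

theorem act_twoB (l k : ℕ) (A B A' B' : Matrix X X ℝ) (f : (Fin (l + k) → X) → ℝ) :
    act (twoB l k A B) (act (twoB l k A' B') f) = act (twoB l k (A * A') (B * B')) f := by
  rw [act_act]
  congr 2
  ext r : 1
  unfold twoB
  split_ifs <;> rfl

theorem twoB_same (l k : ℕ) (A : Matrix X X ℝ) : twoB l k A A = fun _ => A := by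
  ext r : 1; simp [twoB]

/-- A matrix viewed as a function on words. -/
def tilde (l k : ℕ) : Matrix (Fin l → X) (Fin k → X) ℝ →ₗ[ℝ] ((Fin (l + k) → X) → ℝ) where
  toFun M c := M (fun i => c (Fin.castAdd k i)) (fun j => c (Fin.natAdd l j))
  map_add' _ _ := rfl
  map_smul' _ _ := rfl

theorem tilde_apply (l k : ℕ) (M : Matrix (Fin l → X) (Fin k → X) ℝ) (c : Fin (l + k) → X) :
    tilde l k M c = M (fun i => c (Fin.castAdd k i)) (fun j => c (Fin.natAdd l j)) := rfl

theorem tilde_injective (l k : ℕ) :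
    Function.Injective (tilde l k : Matrix (Fin l → X) (Fin k → X) ℝ →ₗ[ℝ] _) := by
  intro M M' h
  ext I J
  have := congrFun h (Fin.append I J)
  simpa [tilde_apply] using this

theorem act_twoB_tilde (l k : ℕ) (A B : Matrix X X ℝ) (M : Matrix (Fin l → X) (Fin k → X) ℝ)
    (c : Fin (l + k) → X) :
    act (twoB l k A B) (tilde l k M) c =
      ∑ I : Fin l → X, ∑ J : Fin k → X,
        ((∏ r, A (c (Fin.castAdd k r)) (I r)) * (∏ r, B (c (Fin.natAdd l r)) (J r))) * M I J := by
  rw [act_apply, ← Equiv.sum_comp (Fin.appendEquiv l k), Fintype.sum_prod_type]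
  refine Finset.sum_congr rfl fun I _ => Finset.sum_congr rfl fun J _ => ?_
  rw [Fin.prod_univ_add]
  simp [tilde_apply, twoB, Fin.appendEquiv]

end transfer

theorem tilde_left {n : ℕ} (l k : ℕ) (g : Matrix (Fin n) (Fin n) ℝ)
    (M : Matrix (Fin l → Fin n) (Fin k → Fin n) ℝ) :
    act (twoB l k g 1) (tilde l k M) = tilde l k (tpowM l g * M) := by
  ext c
  rw [act_twoB_tilde, tilde_apply, Matrix.mul_apply]
  refine Finset.sum_congr rfl fun I _ => ?_
  rw [Finset.sum_eq_single (fun j => c (Fin.natAdd l j))]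
  · simp [tpowM]
  · intro J _ hJ
    obtain ⟨r, hr⟩ := Function.ne_iff.mp hJ
    have : ∏ r, (1 : Matrix (Fin n) (Fin n) ℝ) (c (Fin.natAdd l r)) (J r) = 0 :=
      Finset.prod_eq_zero (Finset.mem_univ r) (Matrix.one_apply_ne hr.symm)
    rw [this]; simp
  · simp

theorem tilde_right {n : ℕ} (l k : ℕ) (g : Matrix (Fin n) (Fin n) ℝ)
    (M : Matrix (Fin l → Fin n) (Fin k → Fin n) ℝ) :
    act (twoB l k 1 gᵀ) (tilde l k M) = tilde l k (M * tpowM k g) := by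
  ext c
  rw [act_twoB_tilde, tilde_apply, Matrix.mul_apply, Finset.sum_comm]
  refine Finset.sum_congr rfl fun J _ => ?_
  rw [Finset.sum_eq_single (fun j => c (Fin.castAdd k j))]
  · simp [tpowM, mul_comm]
  · intro I _ hI
    obtain ⟨r, hr⟩ := Function.ne_iff.mp hI
    have : ∏ r, (1 : Matrix (Fin n) (Fin n) ℝ) (c (Fin.castAdd k r)) (I r) = 0 :=
      Finset.prod_eq_zero (Finset.mem_univ r) (Matrix.one_apply_ne hr.symm)
    rw [this]; simp
  · simp

/-- The transfer map to functions on words. -/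
def Psi {n : ℕ} (S : SymData (Fin n)) (k l : ℕ) :
    (((Fin k → Fin n) → ℝ) →ₗ[ℝ] ((Fin l → Fin n) → ℝ)) →ₗ[ℝ] ((Fin (l + k) → Fin n) → ℝ) :=
  act (twoB l k S.Om 1) ∘ₗ tilde l k ∘ₗ LinearMap.toMatrix'.toLinearMap

theorem Psi_apply {n : ℕ} (S : SymData (Fin n)) (k l : ℕ)
    (φ : ((Fin k → Fin n) → ℝ) →ₗ[ℝ] ((Fin l → Fin n) → ℝ)) :
    Psi S k l φ = act (twoB l k S.Om 1) (tilde l k (LinearMap.toMatrix' φ)) := rfl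

theorem act_twoB_injective {n : ℕ} (l k : ℕ) (A B : Matrix (Fin n) (Fin n) ℝ) (h : B * A = 1) :
    Function.Injective (act (twoB l k A 1)) := by
  intro f f' hf
  have := congrArg (act (twoB l k B 1)) hf
  simpa [act_twoB, h, twoB_same, act_one] using this

theorem Psi_injective {n : ℕ} (S : SymData (Fin n)) (k l : ℕ) :
    Function.Injective (Psi S k l) := by
  intro φ φ' h
  exact LinearMap.toMatrix'.injective (tilde_injective l k (act_twoB_injective l k S.Om S.Omᵀ
    (mul_eq_one_comm.mp (Om_Omt S)) h))

theorem mem_iff_isInv {n : ℕ} (S : SymData (Fin n)) (k l : ℕ)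
    (φ : ((Fin k → Fin n) → ℝ) →ₗ[ℝ] ((Fin l → Fin n) → ℝ)) :
    φ ∈ EquivSub k l (fun g => gᵀ * S.Om * g = S.Om) ↔ IsInv S (Psi S k l φ) := by
  have hOm := Om_Omt S
  have hOm' : S.Omᵀ * S.Om = 1 := mul_eq_one_comm.mp hOm
  change (∀ g : Matrix (Fin n) (Fin n) ℝ, gᵀ * S.Om * g = S.Om →
    φ ∘ₗ (tpowM k g).mulVecLin = (tpowM l g).mulVecLin ∘ₗ φ) ↔ _
  unfold IsInv
  refine forall_congr' fun g => imp_congr_right fun hg => ?_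
  have e1 : φ ∘ₗ (tpowM k g).mulVecLin = (tpowM l g).mulVecLin ∘ₗ φ ↔
      act (twoB l k 1 gᵀ) (tilde l k (LinearMap.toMatrix' φ)) =
      act (twoB l k g 1) (tilde l k (LinearMap.toMatrix' φ)) := by
    rw [tilde_left, tilde_right, (tilde_injective l k).eq_iff,
      ← LinearMap.toMatrix'.injective.eq_iff, LinearMap.toMatrix'_comp, LinearMap.toMatrix'_comp,
      ← Matrix.toLin'_apply', ← Matrix.toLin'_apply', LinearMap.toMatrix'_toLin',
      LinearMap.toMatrix'_toLin']
  have hinv : (g * S.Omᵀ) * (gᵀ * S.Om) = 1 := by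
    apply mul_eq_one_comm.mp
    rw [← Matrix.mul_assoc, hg, hOm]
  rw [e1, ← (act_twoB_injective l k (gᵀ * S.Om) (g * S.Omᵀ) hinv).eq_iff, Psi_apply,
    ← twoB_same l k gᵀ, act_twoB, act_twoB, act_twoB]
  simp [hg]

theorem Psi_brauer {n : ℕ} (S : SymData (Fin n)) (hS : S.Om = OmegaM n) (k l : ℕ)
    (β : BrauerPairing (l + k)) :
    Psi S k l (sympBrauerMatrix n k l β).mulVecLin = fB S β := by
  rw [Psi_apply, ← Matrix.toLin'_apply', LinearMap.toMatrix'_toLin']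
  let G : Fin (l + k) → Matrix (Fin n) (Fin n) ℝ := fun p =>
    if ((p : ℕ) < l ↔ ((β.pair p : Fin (l + k)) : ℕ) < l) then S.Om else 1
  have h1 : tilde l k (sympBrauerMatrix n k l β) =
      fun c' => ∏ p ∈ Finset.univ.filter (fun p => p < β.pair p),
        G p (c' p) (c' (β.pair p)) := by
    ext c
    rw [tilde_apply]
    simp only [sympBrauerMatrix, Matrix.of_apply]
    refine Finset.prod_congr rfl fun p _ => ?_
    rw [Fin.append_castAdd_natAdd]
    simp only [G, hS]
    split_ifs with h2 h3
    · rfl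
    · rw [h3, Matrix.one_apply_eq]
    · rw [Matrix.one_apply_ne h3]
  rw [h1]
  ext c
  rw [act_blocks]
  unfold fB
  refine Finset.prod_congr rfl fun p hp => ?_
  have hlt : (p : ℕ) < (β.pair p : ℕ) := by simpa using hp
  congr 1
  have hOm := Om_Omt S
  by_cases a1 : (p : ℕ) < l <;> by_cases a2 : ((β.pair p : Fin (l + k)) : ℕ) < l
  · simp [G, twoB, a1, a2, Matrix.mul_assoc, hOm]
  · simp [G, twoB, a1, a2]
  · omega
  · simp [G, twoB, a1, a2]

/-- For `n = 2m`, `l + k` even and `n ≥ l + k`, the maps `F_β` are linearly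
independent, hence form a basis of `Hom_{Sp(n)}((ℝⁿ)^{⊗k}, (ℝⁿ)^{⊗l})`; in
particular the dimension of this space equals `(l + k - 1)!!`. -/
theorem stmt7 (n m k l : ℕ) (hm : 1 ≤ m) (hn : n = 2 * m) (heven : Even (l + k))
    (hnk : l + k ≤ n) :
    LinearIndependent ℝ
      (fun β : BrauerPairing (l + k) => (sympBrauerMatrix n k l β).mulVecLin) ∧
    Submodule.span ℝ
      {φ : ((Fin k → Fin n) → ℝ) →ₗ[ℝ] ((Fin l → Fin n) → ℝ) |
        ∃ β : BrauerPairing (l + k), φ = (sympBrauerMatrix n k l β).mulVecLin}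
      = EquivSub k l (fun g => gᵀ * OmegaM n * g = OmegaM n) ∧
    Module.finrank ℝ
        (EquivSub (n := n) k l (fun g => gᵀ * OmegaM n * g = OmegaM n)) =
      Nat.doubleFactorial (l + k - 1) := by
  subst hn
  have hN : l + k ≤ Fintype.card (Fin (2 * m)) := by simpa using hnk
  have hOm := finSym_Om m
  have hli : LinearIndependent ℝ
      (fun β : BrauerPairing (l + k) => (sympBrauerMatrix (2 * m) k l β).mulVecLin) := by
    apply LinearIndependent.of_comp (Psi (finSym m) k l)
    have : (Psi (finSym m) k l) ∘ (fun β : BrauerPairing (l + k) =>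
        (sympBrauerMatrix (2 * m) k l β).mulVecLin) = fun β => fB (finSym m) β :=
      funext fun β => Psi_brauer (finSym m) hOm k l β
    rw [this]
    exact fB_linInd (finSym m) hN
  have hspan : Submodule.span ℝ
      {φ : ((Fin k → Fin (2 * m)) → ℝ) →ₗ[ℝ] ((Fin l → Fin (2 * m)) → ℝ) |
        ∃ β : BrauerPairing (l + k), φ = (sympBrauerMatrix (2 * m) k l β).mulVecLin}
      = EquivSub k l (fun g => gᵀ * OmegaM (2 * m) * g = OmegaM (2 * m)) := by
    rw [← hOm]
    apply le_antisymm
    · rw [Submodule.span_le]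
      rintro φ ⟨β, rfl⟩
      rw [SetLike.mem_coe, mem_iff_isInv, Psi_brauer _ hOm]
      exact fB_inv _ β
    · intro φ hφ
      rw [mem_iff_isInv] at hφ
      obtain ⟨a, ha⟩ := inv_eq_sum (finSym m) hN _ hφ
      have h1 : φ = ∑ β, a β • (sympBrauerMatrix (2 * m) k l β).mulVecLin := by
        apply Psi_injective (finSym m) k l
        rw [ha, map_sum]
        refine Finset.sum_congr rfl fun β _ => ?_
        rw [map_smul, Psi_brauer _ hOm]
      rw [h1]
      exact Submodule.sum_mem _ fun β _ => Submodule.smul_mem _ _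
        (Submodule.subset_span ⟨β, rfl⟩)
  refine ⟨hli, hspan, ?_⟩
  rw [← hspan]
  have hset : {φ : ((Fin k → Fin (2 * m)) → ℝ) →ₗ[ℝ] ((Fin l → Fin (2 * m)) → ℝ) |
        ∃ β : BrauerPairing (l + k), φ = (sympBrauerMatrix (2 * m) k l β).mulVecLin} =
      Set.range (fun β : BrauerPairing (l + k) => (sympBrauerMatrix (2 * m) k l β).mulVecLin) := by
    ext φ
    simp [eq_comm]
  rw [hset, finrank_span_eq_card hli]
  obtain ⟨r, hr⟩ := heven
  rw [← two_mul] at hr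
  rw [hr]
  exact card_brauer r
end
end
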